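/- Let l ≥ 1, let σ_1, …, σ_l > 0, and let ν be the product Gaussian law on ℝˡ whose j-th coordinate has law N(m_j, σ_j²) (independent components). For every rate R ≥ 0, every blocklength n ≥ 1, and every code consisting of a measurable encoder f : (ℝˡ)ⁿ → Fin M with M ≤ 2^(nR) codewords and a decoder g : Fin M → (ℝˡ)ⁿ, the expected per-vector squared-error distortion satisfies E[(1/n) Σ_{i=1}^n ‖X_i − (g(f(X)))_i‖²] ≥ min { Σ_{j=1}^l σ_j² · 2^(−2ρ_j) : ρ ∈ ℝˡ, ρ_j ≥ 0 for all j, Σ_{j=1}^l ρ_j ≤ R }, where X = (X_1, …, X_n) consists of n i.i.d. samples from ν and ‖·‖ is the Euclidean norm on ℝˡ. (Converse part of Theorem 2 of the paper for a Gaussian memoryless vector source with independent components.) -/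

import Mathlib

open MeasureTheory ProbabilityTheory

/-- Expected per-vector squared-error distortion of a blocklength-`n` code `(f, g)` with
`M` codewords on an `ℝˡ`-valued source with i.i.d. vector samples of law `ν`. -/
noncomputable def vecExpectedDistortion (l n M : ℕ) (ν : Measure (Fin l → ℝ))
    (f : (Fin n → Fin l → ℝ) → Fin M) (g : Fin M → Fin n → Fin l → ℝ) : ℝ :=
  ∫ x, (1 / (n : ℝ)) * ∑ i, ∑ j, (x i j - g (f x) i j) ^ 2
    ∂(Measure.pi fun _ : Fin n => ν)

/-- Optimal value of the bit-allocation problem with variances `σⱼ²` and rate budget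
`R`: the minimum of `∑ⱼ σⱼ² 2^(-2ρⱼ)` over `ρ ≥ 0` with `∑ⱼ ρⱼ ≤ R`. -/
noncomputable def bitAllocationValue (l : ℕ) (σ : Fin l → ℝ) (R : ℝ) : ℝ :=
  sInf {d : ℝ | ∃ ρ : Fin l → ℝ, (∀ j, 0 ≤ ρ j) ∧ (∑ j, ρ j) ≤ R ∧
    d = ∑ j, (σ j) ^ 2 * 2 ^ (-(2 * ρ j))}


lemma aux_kernel_big (m s θ y : ℝ) (hs : 0 < s) (hθ : 0 < θ) :
    Integrable (fun x => Real.exp (Real.log (s / θ) / 2 + (x - m) ^ 2 / (2 * s)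
      - (x - y) ^ 2 / (2 * θ))) (gaussianReal m s.toNNReal) ∧
    ∫ x, Real.exp (Real.log (s / θ) / 2 + (x - m) ^ 2 / (2 * s)
      - (x - y) ^ 2 / (2 * θ)) ∂(gaussianReal m s.toNNReal) = 1 := by
  have hv : s.toNNReal ≠ 0 := by simpa using hs
  have hv2 : θ.toNNReal ≠ 0 := by simpa using hθ
  have key : ∀ x, gaussianPDFReal m s.toNNReal x * Real.exp (Real.log (s / θ) / 2
      + (x - m) ^ 2 / (2 * s) - (x - y) ^ 2 / (2 * θ)) = gaussianPDFReal y θ.toNNReal x := by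
    intro x
    have e1 : Real.exp (Real.log (s / θ) / 2) = √(s / θ) := by
      rw [Real.sqrt_eq_rpow, Real.rpow_def_of_pos (by positivity)]
      congr 1; ring
    simp only [gaussianPDFReal, Real.coe_toNNReal _ hs.le, Real.coe_toNNReal _ hθ.le]
    rw [sub_eq_add_neg (_ + _) (_ / _), Real.exp_add, Real.exp_add, e1, Real.sqrt_div hs.le]
    rw [Real.sqrt_mul (by positivity) s, Real.sqrt_mul (by positivity) θ]
    have h1 : Real.exp (-(x - m) ^ 2 / (2 * s)) * Real.exp ((x - m) ^ 2 / (2 * s)) = 1 := by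
      rw [← Real.exp_add, ← Real.exp_zero]; congr 1; ring
    have h2 : √s ≠ 0 := by positivity
    have h3 : √θ ≠ 0 := by positivity
    have h4 : √(2 * Real.pi) ≠ 0 := by positivity
    calc _ = (√(2 * Real.pi) * √s)⁻¹ * (√s / √θ) * (Real.exp (-(x - m) ^ 2 / (2 * s)) *
        Real.exp ((x - m) ^ 2 / (2 * s))) * Real.exp (-((x - y) ^ 2 / (2 * θ))) := by ring
      _ = _ := by
        rw [h1, neg_div]
        field_simp
  constructor
  · rw [gaussianReal_of_var_ne_zero _ hv, integrable_withDensity_iff_integrable_smul'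
      (measurable_gaussianPDF _ _) (ae_of_all _ fun _ => gaussianPDF_lt_top)]
    simp only [toReal_gaussianPDF, smul_eq_mul, key]
    exact integrable_gaussianPDFReal _ _
  · rw [integral_gaussianReal_eq_integral_smul hv]
    simp only [smul_eq_mul, key]
    exact integral_gaussianPDFReal_eq_one _ hv2

lemma aux_kernel_small (m s θ y : ℝ) (hs : 0 < s) (hθ : 0 < θ) (h : s ≤ θ) :
    Integrable (fun x => Real.exp (Real.log (θ / θ) / 2 + (x - m) ^ 2 / (2 * θ)
      - (x - y) ^ 2 / (2 * θ))) (gaussianReal m s.toNNReal) ∧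
    ∫ x, Real.exp (Real.log (θ / θ) / 2 + (x - m) ^ 2 / (2 * θ)
      - (x - y) ^ 2 / (2 * θ)) ∂(gaussianReal m s.toNNReal) ≤ 1 := by
  have key : ∀ x, Real.exp (Real.log (θ / θ) / 2 + (x - m) ^ 2 / (2 * θ)
      - (x - y) ^ 2 / (2 * θ)) = Real.exp ((m ^ 2 - y ^ 2) / (2 * θ)) *
        Real.exp ((y - m) / θ * x) := by
    intro x
    rw [← Real.exp_add, div_self hθ.ne', Real.log_one]
    congr 1; field_simp; ring
  simp only [key]
  refine ⟨(integrable_exp_mul_gaussianReal _).const_mul _, ?_⟩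
  rw [integral_const_mul]
  have := congrFun (mgf_fun_id_gaussianReal (μ := m) (v := s.toNNReal)) ((y - m) / θ)
  simp only [mgf] at this
  rw [this, ← Real.exp_add, Real.exp_le_one_iff, Real.coe_toNNReal _ hs.le]
  have : (m ^ 2 - y ^ 2) / (2 * θ) + (m * ((y - m) / θ) + s * ((y - m) / θ) ^ 2 / 2)
    = - ((y - m) ^ 2 * (θ - s) / (2 * θ ^ 2)) := by field_simp; ring
  rw [this, neg_nonpos]
  have := sub_nonneg.2 h
  positivity

lemma aux_kernel (m s θ y : ℝ) (hs : 0 < s) (hθ : 0 < θ) :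
    Integrable (fun x => Real.exp (Real.log (max s θ / θ) / 2 + (x - m) ^ 2 / (2 * max s θ)
      - (x - y) ^ 2 / (2 * θ))) (gaussianReal m s.toNNReal) ∧
    ∫ x, Real.exp (Real.log (max s θ / θ) / 2 + (x - m) ^ 2 / (2 * max s θ)
      - (x - y) ^ 2 / (2 * θ)) ∂(gaussianReal m s.toNNReal) ≤ 1 := by
  rcases le_total s θ with h | h
  · rw [max_eq_right h]; exact aux_kernel_small m s θ y hs hθ h
  · rw [max_eq_left h]; exact ⟨(aux_kernel_big m s θ y hs hθ).1, (aux_kernel_big m s θ y hs hθ).2.le⟩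

lemma aux_sq_int (m s y : ℝ) :
    Integrable (fun x => (x - y) ^ 2) (gaussianReal m s.toNNReal) := by
  have h := (memLp_id_gaussianReal (μ := m) (v := s.toNNReal) 2)
  have h2 : MemLp (fun x : ℝ => x - y) 2 (gaussianReal m s.toNNReal) := 
    MemLp.sub h (memLp_const y)
  exact h2.integrable_sq

lemma aux_var (m s : ℝ) (hs : 0 < s) :
    ∫ x, (x - m) ^ 2 ∂(gaussianReal m s.toNNReal) = s := by
  have h := variance_fun_id_gaussianReal (μ := m) (v := s.toNNReal)
  rw [variance_eq_integral (by fun_prop)] at h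
  simpa [Real.coe_toNNReal _ hs.le] using h

lemma aux_main (l n M : ℕ) (m s : Fin l → ℝ) (hs : ∀ j, 0 < s j) (hn : 1 ≤ n) (θ : ℝ) (hθ : 0 < θ)
    (f : (Fin n → Fin l → ℝ) → Fin M) (hf : Measurable f)
    (g : Fin M → Fin n → Fin l → ℝ) :
    n * ∑ j, (Real.log (max (s j) θ / θ) / 2 + s j / (2 * max (s j) θ)) - Real.log M ≤
     (∫ x, (1 / (n : ℝ)) * ∑ i, ∑ j, (x i j - g (f x) i j) ^ 2
    ∂(Measure.pi fun _ : Fin n => Measure.pi fun j => gaussianReal (m j) (s j).toNNReal))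
      * n / (2 * θ) := by
  set P := (Measure.pi fun _ : Fin n => Measure.pi fun j => gaussianReal (m j) (s j).toNNReal) with hP
  have hMpos : 0 < M := (Nat.zero_le _).trans_lt (f 0).2
  have hM' : (0 : ℝ) < M := by exact_mod_cast hMpos
  -- quadratic integrability
  have hq : ∀ i j y, Integrable (fun x : Fin n → Fin l → ℝ => (x i j - y) ^ 2) P := by
    intro i j y
    have h1 := integrable_comp_eval (μ := fun j => gaussianReal (m j) (s j).toNNReal)
      (i := j) (aux_sq_int (m j) (s j) y)
    exact integrable_comp_eval (μ := fun _ : Fin n => Measure.pi fun j => gaussianReal (m j) (s j).toNNReal)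
      (i := i) h1
  have hv : ∀ i j, ∫ x : Fin n → Fin l → ℝ, (x i j - m j) ^ 2 ∂P = s j := by
    intro i j
    have h1 := integral_comp_eval (μ := fun j => gaussianReal (m j) (s j).toNNReal)
      (i := j) (aux_sq_int (m j) (s j) (m j)).aestronglyMeasurable
    have h0 := integrable_comp_eval (μ := fun j => gaussianReal (m j) (s j).toNNReal)
      (i := j) (aux_sq_int (m j) (s j) (m j))
    have h2 := integral_comp_eval (μ := fun _ : Fin n => Measure.pi fun j => gaussianReal (m j) (s j).toNNReal)
      (i := i) h0.aestronglyMeasurable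
    rw [h1, aux_var _ _ (hs j)] at h2
    exact h2
  have hgf : ∀ i j, Measurable (fun x => g (f x) i j) := fun i j =>
    (measurable_of_finite (fun k => g k i j)).comp hf
  have hxm : ∀ i j, Measurable (fun x : Fin n → Fin l → ℝ => x i j) := fun i j => by fun_prop
  have hd : ∀ i j, Integrable (fun x : Fin n → Fin l → ℝ => (x i j - g (f x) i j) ^ 2) P := by
    intro i j
    refine (integrable_finsetSum Finset.univ fun k _ => hq i j (g k i j)).mono'
      (((hxm i j).sub (hgf i j)).pow_const 2).aestronglyMeasurable (ae_of_all _ fun x => ?_)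
    rw [Real.norm_of_nonneg (sq_nonneg _)]
    exact Finset.single_le_sum (f := fun k => (x i j - g k i j) ^ 2) (fun k _ => sq_nonneg _)
      (Finset.mem_univ (f x))
  -- exponent
  let E : Fin M → (Fin n → Fin l → ℝ) → ℝ := fun k x => ∑ i, ∑ j,
    (Real.log (max (s j) θ / θ) / 2 + (x i j - m j) ^ 2 / (2 * max (s j) θ)
      - (x i j - g k i j) ^ 2 / (2 * θ))
  have hE : ∀ k, Integrable (fun x => Real.exp (E k x)) P ∧ ∫ x, Real.exp (E k x) ∂P ≤ 1 := by
    intro k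
    simp only [E, Real.exp_sum]
    constructor
    · refine Integrable.fintype_prod (f := fun i (z : Fin l → ℝ) => ∏ j, Real.exp (Real.log (max (s j) θ / θ) / 2 + (z j - m j) ^ 2 / (2 * max (s j) θ)
      - (z j - g k i j) ^ 2 / (2 * θ))) fun i => ?_
      exact Integrable.fintype_prod (f := fun j z => Real.exp (Real.log (max (s j) θ / θ) / 2 + (z - m j) ^ 2 / (2 * max (s j) θ)
      - (z - g k i j) ^ 2 / (2 * θ))) fun j => (aux_kernel _ _ _ _ (hs j) hθ).1
    · rw [hP, integral_fintype_prod_eq_prod (f := fun i (z : Fin l → ℝ) => ∏ j, Real.exp (Real.log (max (s j) θ / θ) / 2 + (z j - m j) ^ 2 / (2 * max (s j) θ)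
      - (z j - g k i j) ^ 2 / (2 * θ)))]
      refine Finset.prod_le_one (fun i _ => integral_nonneg fun z => by positivity) fun i _ => ?_
      rw [integral_fintype_prod_eq_prod (f := fun j z => Real.exp (Real.log (max (s j) θ / θ) / 2 + (z - m j) ^ 2 / (2 * max (s j) θ)
      - (z - g k i j) ^ 2 / (2 * θ)))]
      exact Finset.prod_le_one (fun i _ => integral_nonneg fun z => by positivity) fun j _ =>
        (aux_kernel _ _ _ _ (hs j) hθ).2
  have hterm : ∀ i j, Integrable (fun x : Fin n → Fin l → ℝ => Real.log (max (s j) θ / θ) / 2 + (x i j - m j) ^ 2 / (2 * max (s j) θ)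
      - (x i j - g (f x) i j) ^ 2 / (2 * θ)) P := fun i j =>
    ((integrable_const _).add ((hq i j _).div_const _)).sub ((hd i j).div_const _)
  have hEf : Integrable (fun x => E (f x) x) P :=
    integrable_finsetSum _ fun i _ => integrable_finsetSum _ fun j _ => hterm i j
  have hub : ∫ x, (E (f x) x - Real.log M + 1) ∂P ≤ ∫ x, (∑ k, Real.exp (E k x)) / M ∂P := by
    refine integral_mono ((hEf.sub (integrable_const _)).add (integrable_const _))
      ((integrable_finsetSum _ fun k _ => (hE k).1).div_const _) fun x => ?_
    calc _ ≤ Real.exp (E (f x) x - Real.log M) := Real.add_one_le_exp _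
      _ = Real.exp (E (f x) x) / M := by rw [Real.exp_sub, Real.exp_log hM']
      _ ≤ _ := by
        gcongr
        exact Finset.single_le_sum (f := fun k => Real.exp (E k x)) (fun k _ => (Real.exp_pos _).le)
          (Finset.mem_univ (f x))
  have hub2 : ∫ x, (∑ k, Real.exp (E k x)) / M ∂P ≤ 1 := by
    rw [integral_div, integral_finsetSum _ fun k _ => (hE k).1, div_le_one hM']
    calc _ ≤ ∑ k : Fin M, (1 : ℝ) := Finset.sum_le_sum fun k _ => (hE k).2
      _ = M := by simp
  have hexp : ∫ x, (E (f x) x - Real.log M + 1) ∂P = ∫ x, E (f x) x ∂P - Real.log M + 1 := by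
    have hA : Integrable (fun x => E (f x) x - Real.log M) P := hEf.sub (integrable_const _)
    rw [integral_add hA (integrable_const _),
      integral_sub hEf (integrable_const _)]
    simp
  have hEint : ∫ x, E (f x) x ∂P = n * ∑ j, (Real.log (max (s j) θ / θ) / 2 + s j / (2 * max (s j) θ))
      - (∑ i, ∑ j, ∫ x, (x i j - g (f x) i j) ^ 2 ∂P) / (2 * θ) := by
    simp only [E]
    rw [integral_finsetSum _ fun i _ => integrable_finsetSum _ fun j _ => hterm i j]
    have : ∀ i, ∫ x, (∑ j, (Real.log (max (s j) θ / θ) / 2 + (x i j - m j) ^ 2 / (2 * max (s j) θ)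
      - (x i j - g (f x) i j) ^ 2 / (2 * θ))) ∂P = ∑ j, (Real.log (max (s j) θ / θ) / 2 + s j / (2 * max (s j) θ)) - (∑ j, ∫ x, (x i j - g (f x) i j) ^ 2 ∂P) / (2 * θ) := by
      intro i
      rw [integral_finsetSum _ fun j _ => hterm i j, Finset.sum_div, ← Finset.sum_sub_distrib]
      refine Finset.sum_congr rfl fun j _ => ?_
      have hA : Integrable (fun x : Fin n → Fin l → ℝ => Real.log (max (s j) θ / θ) / 2
          + (x i j - m j) ^ 2 / (2 * max (s j) θ)) P :=
        (integrable_const _).add ((hq i j _).div_const _)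
      rw [integral_sub hA ((hd i j).div_const _),
        integral_add (integrable_const _) ((hq i j _).div_const _), integral_div, integral_div, integral_div, hv]
      simp
    rw [Finset.sum_congr rfl fun i _ => this i, Finset.sum_sub_distrib, Finset.sum_div]
    simp
  have hD : (∫ x, (1 / (n : ℝ)) * ∑ i, ∑ j, (x i j - g (f x) i j) ^ 2 ∂P) * n
      = ∑ i, ∑ j, ∫ x, (x i j - g (f x) i j) ^ 2 ∂P := by
    rw [integral_const_mul, integral_finsetSum _ fun i _ => integrable_finsetSum _ fun j _ => hd i j]
    have : (n : ℝ) ≠ 0 := by positivity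
    rw [Finset.sum_congr rfl fun i _ => integral_finsetSum _ fun j _ => hd i j]
    field_simp
  rw [hD]
  linarith

lemma aux_theta (l : ℕ) (hl : 1 ≤ l) (s : Fin l → ℝ) (hs : ∀ j, 0 < s j) (R : ℝ) (hR : 0 ≤ R) :
    ∃ θ, 0 < θ ∧ ∑ j, Real.log (max (s j) θ / θ) / 2 = R * Real.log 2 := by
  let h : ℝ → ℝ := fun θ => ∑ j, Real.log (max (s j) θ / θ) / 2
  let j0 : Fin l := ⟨0, hl⟩
  set a := s j0 * Real.exp (-(2 * (R * Real.log 2))) with ha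
  have hapos : 0 < a := mul_pos (hs _) (Real.exp_pos _)
  set b := ∑ j, s j with hb
  have hsb : ∀ j, s j ≤ b := fun j => Finset.single_le_sum (fun j _ => (hs j).le) (Finset.mem_univ j)
  have h2 : 0 ≤ R * Real.log 2 := mul_nonneg hR (Real.log_nonneg (by norm_num))
  have hab : a ≤ b := by
    refine le_trans ?_ (hsb j0)
    have : Real.exp (-(2 * (R * Real.log 2))) ≤ 1 := Real.exp_le_one_iff.2 (by linarith)
    nlinarith [hs j0]
  have hc : ContinuousOn h (Set.Icc a b) := by
    refine continuousOn_finsetSum _ fun j _ => ContinuousOn.div_const (ContinuousOn.log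
      (ContinuousOn.div (by fun_prop) (by fun_prop) ?_) ?_) _
    · intro x hx; exact (hapos.trans_le hx.1).ne'
    · intro x hx
      have := hapos.trans_le hx.1
      have h5 : 0 < max (s j) x := lt_max_of_lt_right this
      exact (div_pos h5 this).ne'
  have hmem : R * Real.log 2 ∈ Set.Icc (h b) (h a) := by
    constructor
    · have : h b = 0 := by
        refine Finset.sum_eq_zero fun j _ => ?_
        rw [max_eq_right (hsb j), div_self (hapos.trans_le hab).ne']; simp
      rw [this]; exact h2
    · have h3 : Real.log (max (s j0) a / a) / 2 ≤ h a := by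
        refine Finset.single_le_sum (f := fun j => Real.log (max (s j) a / a) / 2) (fun j _ => ?_) (Finset.mem_univ j0)
        have : 1 ≤ max (s j) a / a := by rw [le_div_iff₀ hapos]; simp
        have := Real.log_nonneg this
        positivity
      refine le_trans ?_ h3
      have : Real.exp (2 * (R * Real.log 2)) ≤ max (s j0) a / a := by
        rw [le_div_iff₀ hapos, ha, mul_comm (s j0), ← mul_assoc, ← Real.exp_add]
        simp
      have := (Real.le_log_iff_exp_le (lt_of_lt_of_le (Real.exp_pos _) this)).2 this
      linarith
  obtain ⟨θ, hθ, he⟩ := intermediate_value_Icc' hab hc hmem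
  exact ⟨θ, hapos.trans_le hθ.1, he⟩

/-- Converse part of Theorem 2 of the paper for a Gaussian memoryless vector source
with independent components: any blocklength-`n` code with at most `2 ^ (n R)`
codewords has expected per-vector squared-error distortion at least the optimal
value of the bit-allocation problem. -/
theorem gaussian_vector_rate_distortion_converse
    (l : ℕ) (hl : 1 ≤ l) (m σ : Fin l → ℝ) (hσ : ∀ j, 0 < σ j)
    (ν : Measure (Fin l → ℝ))
    (hν : ν = Measure.pi fun j => gaussianReal (m j) (Real.toNNReal ((σ j) ^ 2)))
    (R : ℝ) (hR : 0 ≤ R) (n : ℕ) (hn : 1 ≤ n)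
    (M : ℕ) (hM : (M : ℝ) ≤ 2 ^ ((n : ℝ) * R))
    (f : (Fin n → Fin l → ℝ) → Fin M) (hf : Measurable f)
    (g : Fin M → Fin n → Fin l → ℝ) :
    bitAllocationValue l σ R ≤ vecExpectedDistortion l n M ν f g := by
  subst hν
  obtain ⟨θ, hθ, he⟩ := aux_theta l hl (fun j => σ j ^ 2) (fun j => pow_pos (hσ j) 2) R hR
  have hmain := aux_main l n M m (fun j => σ j ^ 2) (fun j => pow_pos (hσ j) 2) hn θ hθ f hf g
  change _ ≤ vecExpectedDistortion l n M _ f g * n / (2 * θ) at hmain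
  generalize vecExpectedDistortion l n M _ f g = D at hmain ⊢
  have hlog2 : 0 < Real.log 2 := Real.log_pos (by norm_num)
  have hMpos : 0 < M := (Nat.zero_le _).trans_lt (f 0).2
  have hM' : (0 : ℝ) < M := by exact_mod_cast hMpos
  have hn' : (0 : ℝ) < n := by exact_mod_cast hn
  have hlogM : Real.log M ≤ n * R * Real.log 2 := by
    have := Real.log_le_log hM' hM
    rwa [Real.log_rpow (by norm_num)] at this
  rw [Finset.sum_add_distrib, he] at hmain
  have hw : ∀ j, 0 < max (σ j ^ 2) θ := fun j => lt_max_of_lt_right hθ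
  have h1 : ∑ j, σ j ^ 2 / max (σ j ^ 2) θ * θ ≤ D := by
    have h2 : n * ∑ j, σ j ^ 2 / (2 * max (σ j ^ 2) θ) ≤ D * n / (2 * θ) := by linarith
    have h3 : ∑ j, σ j ^ 2 / max (σ j ^ 2) θ * θ
        = (∑ j, σ j ^ 2 / (2 * max (σ j ^ 2) θ)) * (2 * θ) := by
      rw [Finset.sum_mul]
      refine Finset.sum_congr rfl fun j _ => ?_
      have := (hw j).ne'
      field_simp
    rw [h3]
    rw [le_div_iff₀ (by positivity)] at h2
    nlinarith
  refine le_trans (csInf_le ⟨0, ?_⟩ ⟨fun j => Real.log (max (σ j ^ 2) θ / θ) / 2 / Real.log 2,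
    fun j => ?_, ?_, ?_⟩) h1
  · rintro d ⟨ρ, -, -, rfl⟩
    positivity
  · have : 1 ≤ max (σ j ^ 2) θ / θ := by rw [le_div_iff₀ hθ]; simp
    have := Real.log_nonneg this
    positivity
  · rw [← Finset.sum_div, he, mul_div_cancel_right₀ _ hlog2.ne']
  · refine Finset.sum_congr rfl fun j _ => ?_
    have hpos : 0 < max (σ j ^ 2) θ / θ := div_pos (hw j) hθ
    have : (2 : ℝ) ^ (-(2 * (Real.log (max (σ j ^ 2) θ / θ) / 2 / Real.log 2)))
        = (max (σ j ^ 2) θ / θ)⁻¹ := by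
      rw [Real.rpow_def_of_pos (by norm_num), ← Real.exp_log (inv_pos.2 hpos), Real.log_inv]
      congr 1; field_simp
    rw [this, inv_div]; ring
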